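/- There exist constants Θ ≥ 1 and c ≥ 1 such that the following holds. Let κ, T₁, T₂ > 0 with κ²T₁ ≥ Θ and T₂ ≥ T₁, let ρ : [0,1] → [0,∞) and T : [0,1] → (0,∞) be measurable with ∫₀¹ ρ = 1 and T₁ ≤ T(y) ≤ T₂ for all y, and let f be a mild steady state of the linear BGK equation with data (κ, T₁, T₂, ρ, T). Then c^{-1} √(T₁T₂) ≤ ∫_ℝ v² f(1,v) dv ≤ c √(T₁T₂). -/

import Mathlib

open MeasureTheory Real Set

/-- Centered Maxwellian with temperature `T`: `M_T(v) = (2πT)^{-1/2} exp(−v²/(2T))`. -/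
noncomputable def Mxw (T v : ℝ) : ℝ :=
  (Real.sqrt (2 * π * T))⁻¹ * Real.exp (-v ^ 2 / (2 * T))

/-- Wall Maxwellian with temperature `T`: `M̃_T(v) = (1/T) exp(−v²/(2T))`,
normalized so that `∫₀^∞ v M̃_T(v) dv = 1`. -/
noncomputable def wallMxw (T v : ℝ) : ℝ :=
  T⁻¹ * Real.exp (-v ^ 2 / (2 * T))

/-- `C_i = ∫₀^∞ v e^{−1/(κv)} M̃_{T_i}(v) dv`. -/
noncomputable def Cwall (κ T : ℝ) : ℝ :=
  ∫ v in Ioi (0 : ℝ), v * Real.exp (-1 / (κ * v)) * wallMxw T v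

/-- `C₋ = (1/κ) ∫₀¹ ρ(y) (∫₀^∞ e^{−y/(κv)} M_{T(y)}(v) dv) dy`. -/
noncomputable def Cminus (κ : ℝ) (ρ T : ℝ → ℝ) : ℝ :=
  κ⁻¹ * ∫ y in Icc (0 : ℝ) 1, ρ y * ∫ v in Ioi (0 : ℝ), Real.exp (-y / (κ * v)) * Mxw (T y) v

/-- `C₊ = (1/κ) ∫₀¹ ρ(y) (∫₀^∞ e^{−(1−y)/(κv)} M_{T(y)}(v) dv) dy`. -/
noncomputable def Cplus (κ : ℝ) (ρ T : ℝ → ℝ) : ℝ :=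
  κ⁻¹ * ∫ y in Icc (0 : ℝ) 1, ρ y * ∫ v in Ioi (0 : ℝ), Real.exp (-(1 - y) / (κ * v)) * Mxw (T y) v

/-- `f` is a mild steady state of the linear BGK equation with data `(κ, T₁, T₂, ρ, T)`. -/
def IsMildSteadyState (κ T₁ T₂ : ℝ) (ρ T : ℝ → ℝ) (f : ℝ → ℝ → ℝ) : Prop :=
  Cwall κ T₁ * Cwall κ T₂ < 1 ∧
  IntegrableOn
    (fun y => ρ y * ∫ v in Ioi (0 : ℝ), Real.exp (-y / (κ * v)) * Mxw (T y) v)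
    (Icc (0 : ℝ) 1) ∧
  IntegrableOn
    (fun y => ρ y * ∫ v in Ioi (0 : ℝ), Real.exp (-(1 - y) / (κ * v)) * Mxw (T y) v)
    (Icc (0 : ℝ) 1) ∧
  (∀ x ∈ Icc (0 : ℝ) 1, ρ x = ∫ v, f x v) ∧
  (∀ x ∈ Icc (0 : ℝ) 1,
    (∀ᵐ v ∂(volume.restrict (Ioi (0 : ℝ))),
      f x v = Real.exp (-x / (κ * v)) * wallMxw T₁ v *
          ((Cminus κ ρ T + Cwall κ T₂ * Cplus κ ρ T) / (1 - Cwall κ T₁ * Cwall κ T₂)) +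
        ∫ y in (0 : ℝ)..x, (κ * v)⁻¹ * Real.exp (-(x - y) / (κ * v)) * ρ y * Mxw (T y) v) ∧
    (∀ᵐ v ∂(volume.restrict (Iio (0 : ℝ))),
      f x v = Real.exp (-(1 - x) / (κ * |v|)) * wallMxw T₂ v *
          ((Cplus κ ρ T + Cwall κ T₁ * Cminus κ ρ T) / (1 - Cwall κ T₁ * Cwall κ T₂)) +
        ∫ y in x..1, (κ * |v|)⁻¹ * Real.exp (-(y - x) / (κ * |v|)) * ρ y * Mxw (T y) v))

lemma exp_neg_sq_div_eq (s v : ℝ) : exp (-v ^ 2 / s) = exp (-s⁻¹ * v ^ 2) := by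
  congr 1; ring

lemma integrable_exp_neg_sq_div {s : ℝ} (hs : 0 < s) :
    Integrable fun v : ℝ => exp (-v ^ 2 / s) := by
  simp_rw [exp_neg_sq_div_eq]
  exact integrable_exp_neg_mul_sq (inv_pos.2 hs)

lemma integral_exp_neg_sq_div (s : ℝ) : ∫ v : ℝ, exp (-v ^ 2 / s) = √(π * s) := by
  simp_rw [exp_neg_sq_div_eq, integral_gaussian, div_inv_eq_mul]

lemma setIntegral_Ioi_exp_neg_sq_div_le {s : ℝ} (hs : 0 < s) :
    ∫ v in Ioi (0 : ℝ), exp (-v ^ 2 / s) ≤ √(π * s) := by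
  rw [← integral_exp_neg_sq_div]
  exact setIntegral_le_integral (integrable_exp_neg_sq_div hs) (ae_of_all _ fun v => (exp_pos _).le)

/-- A function that is nonnegative on `S` and at least `c` on an interval of length `L` inside `S`
has integral at least `c * L`. -/
lemma mul_length_le_setIntegral {g : ℝ → ℝ} {S : Set ℝ} (hS : MeasurableSet S)
    (hg : IntegrableOn g S) (h0 : ∀ v ∈ S, 0 ≤ g v) {a L c : ℝ} (hL : 0 ≤ L)
    (hsub : Icc a (a + L) ⊆ S) (hc : ∀ v ∈ Icc a (a + L), c ≤ g v) :
    c * L ≤ ∫ v in S, g v := by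
  have h1 := setIntegral_ge_of_const_le_real measurableSet_Icc
    (by simp : volume (Icc a (a + L)) ≠ ⊤) hc (hg.mono_set hsub)
  have h2 : ∫ v in Icc a (a + L), g v ≤ ∫ v in S, g v :=
    setIntegral_mono_set hg ((ae_restrict_iff' hS).2 (ae_of_all _ h0)) hsub.eventuallyLE
  have h3 : volume.real (Icc a (a + L)) = L := by simp [measureReal_def, hL]
  rw [h3] at h1
  exact h1.trans h2

lemma Mxw_nonneg (T v : ℝ) : 0 ≤ Mxw T v := by unfold Mxw; positivity

lemma wallMxw_nonneg {T : ℝ} (hT : 0 < T) (v : ℝ) : 0 ≤ wallMxw T v := by unfold wallMxw; positivity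

lemma integrable_Mxw {T : ℝ} (hT : 0 < T) : Integrable (Mxw T) :=
  (integrable_exp_neg_sq_div (by positivity : 0 < 2 * T)).const_mul _

lemma integrable_wallMxw {T : ℝ} (hT : 0 < T) : Integrable (wallMxw T) :=
  (integrable_exp_neg_sq_div (by positivity : 0 < 2 * T)).const_mul _

lemma integral_Mxw {T : ℝ} (hT : 0 < T) : ∫ v, Mxw T v = 1 := by
  unfold Mxw
  rw [integral_const_mul, integral_exp_neg_sq_div, show π * (2 * T) = 2 * π * T by ring]
  exact inv_mul_cancel₀ (by positivity)

lemma integrable_mul_wallMxw {T : ℝ} (hT : 0 < T) : Integrable fun v => v * wallMxw T v := by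
  have h := (integrable_mul_exp_neg_mul_sq (inv_pos.2 (by positivity : 0 < 2 * T))).const_mul T⁻¹
  refine h.congr (ae_of_all _ fun v => ?_)
  simp only [wallMxw, exp_neg_sq_div_eq]
  ring

lemma setIntegral_Ioi_mul_wallMxw {T : ℝ} (hT : 0 < T) :
    ∫ v in Ioi (0 : ℝ), v * wallMxw T v = 1 := by
  have hd : ∀ v ∈ Ici (0 : ℝ),
      HasDerivAt (fun v : ℝ => -exp (-v ^ 2 / (2 * T))) (v * wallMxw T v) v := by
    intro v _
    have h := ((((hasDerivAt_id v).pow 2).neg.div_const (2 * T)).exp).neg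
    convert! h using 1
    simp only [wallMxw, id]
    simp
    field_simp
  have ht : Filter.Tendsto (fun v : ℝ => -exp (-v ^ 2 / (2 * T))) Filter.atTop (nhds (-0)) := by
    refine (tendsto_exp_atBot.comp ?_).neg
    have h := (Filter.tendsto_pow_atTop (α := ℝ) two_ne_zero).const_mul_atTop_of_neg
      (r := -(2 * T)⁻¹) (by simpa using hT)
    refine h.congr fun v => ?_
    ring
  rw [integral_Ioi_of_hasDerivAt_of_tendsto' hd (integrable_mul_wallMxw hT).integrableOn ht]
  simp

lemma exp_neg_div_le_one {κ x v : ℝ} (hκ : 0 < κ) (hx : 0 ≤ x) (hv : 0 ≤ v) :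
    exp (-x / (κ * v)) ≤ 1 := by
  rw [exp_le_one_iff, neg_div]
  have : 0 ≤ x / (κ * v) := by positivity
  linarith

lemma one_le_kappa_mul_sqrt {κ T : ℝ} (hκ : 0 < κ) (h : 1 ≤ κ ^ 2 * T) : 1 ≤ κ * √T := by
  have h1 : √(κ ^ 2 * T) = κ * √T := by
    rw [sqrt_mul (by positivity), sqrt_sq hκ.le]
  rw [← h1]
  exact one_le_sqrt.2 h

lemma exp_neg_two_le_of_mem {T v : ℝ} (hT : 0 < T) (h : |v| ≤ 2 * √T) :
    exp (-2) ≤ exp (-v ^ 2 / (2 * T)) := by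
  rw [exp_le_exp, le_div_iff₀ (by positivity)]
  have h1 : v ^ 2 ≤ (2 * √T) ^ 2 := sq_le_sq' (by linarith [neg_abs_le v]) ((le_abs_self v).trans h)
  rw [mul_pow, sq_sqrt hT.le] at h1
  linarith

lemma integrableOn_exp_mul {κ x : ℝ} (hκ : 0 < κ) (hx : 0 ≤ x) {g : ℝ → ℝ}
    (hg : IntegrableOn g (Ioi 0)) :
    IntegrableOn (fun v => exp (-x / (κ * v)) * g v) (Ioi 0) := by
  refine Integrable.bdd_mul (c := 1) hg (Measurable.aestronglyMeasurable (by fun_prop)) ?_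
  refine (ae_restrict_iff' measurableSet_Ioi).2 (ae_of_all _ fun v hv => ?_)
  rw [norm_of_nonneg (exp_pos _).le]
  exact exp_neg_div_le_one hκ hx (le_of_lt hv)

lemma integral_exp_mul_Mxw_nonneg (κ x T : ℝ) :
    0 ≤ ∫ v in Ioi (0 : ℝ), exp (-x / (κ * v)) * Mxw T v :=
  integral_nonneg fun v => mul_nonneg (exp_pos _).le (Mxw_nonneg T v)

lemma integral_exp_mul_Mxw_le_one {κ x T : ℝ} (hκ : 0 < κ) (hx : 0 ≤ x) (hT : 0 < T) :
    ∫ v in Ioi (0 : ℝ), exp (-x / (κ * v)) * Mxw T v ≤ 1 := by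
  rw [← integral_Mxw hT]
  refine le_trans ?_ (setIntegral_le_integral (s := Ioi 0) (integrable_Mxw hT)
    (ae_of_all _ (Mxw_nonneg T)))
  refine setIntegral_mono_on (integrableOn_exp_mul hκ hx (integrable_Mxw hT).integrableOn)
    (integrable_Mxw hT).integrableOn measurableSet_Ioi fun v hv => ?_
  exact mul_le_of_le_one_left (Mxw_nonneg T v) (exp_neg_div_le_one hκ hx (le_of_lt hv))

lemma le_integral_exp_mul_Mxw {κ x T : ℝ} (hκ : 0 < κ) (hx : 0 ≤ x) (hx1 : x ≤ 1) (hT : 0 < T)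
    (h : 1 ≤ κ ^ 2 * T) :
    exp (-3) / √(2 * π) ≤ ∫ v in Ioi (0 : ℝ), exp (-x / (κ * v)) * Mxw T v := by
  have hs : 0 < √T := sqrt_pos.2 hT
  have key := mul_length_le_setIntegral (a := √T) (L := √T)
    (c := exp (-1) * ((√(2 * π * T))⁻¹ * exp (-2))) measurableSet_Ioi
    (integrableOn_exp_mul hκ hx (integrable_Mxw hT).integrableOn)
    (fun v _ => mul_nonneg (exp_pos _).le (Mxw_nonneg T v)) hs.le
    (fun v hv => lt_of_lt_of_le hs hv.1) ?_
  · refine le_trans (le_of_eq ?_) key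
    rw [sqrt_mul (by positivity : (0 : ℝ) ≤ 2 * π), show (-3 : ℝ) = -1 + -2 by norm_num, exp_add]
    field_simp
  · intro v hv
    have hv0 : 0 < v := lt_of_lt_of_le hs hv.1
    have hkv : 1 ≤ κ * v := (one_le_kappa_mul_sqrt hκ h).trans (by gcongr; exact hv.1)
    refine mul_le_mul ?_ ?_ (by positivity) (exp_pos _).le
    · rw [exp_le_exp, le_div_iff₀ (by positivity)]
      linarith
    · unfold Mxw
      refine mul_le_mul_of_nonneg_left (exp_neg_two_le_of_mem hT ?_) (by positivity)
      rw [abs_of_pos hv0]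
      linarith [hv.2]

lemma integrableOn_Cwall {κ T : ℝ} (hκ : 0 < κ) (hT : 0 < T) :
    IntegrableOn (fun v => v * exp (-1 / (κ * v)) * wallMxw T v) (Ioi 0) := by
  refine (integrableOn_exp_mul hκ zero_le_one
    (integrable_mul_wallMxw hT).integrableOn).congr_fun (fun v _ => ?_) measurableSet_Ioi
  ring

lemma Cwall_nonneg {κ T : ℝ} (hT : 0 < T) : 0 ≤ Cwall κ T :=
  setIntegral_nonneg measurableSet_Ioi fun v hv =>
    mul_nonneg (mul_nonneg (le_of_lt hv) (exp_pos _).le) (wallMxw_nonneg hT v)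

lemma one_sub_Cwall_eq {κ T : ℝ} (hκ : 0 < κ) (hT : 0 < T) :
    1 - Cwall κ T = ∫ v in Ioi (0 : ℝ), v * (1 - exp (-1 / (κ * v))) * wallMxw T v := by
  have h := integral_sub (integrable_mul_wallMxw hT).integrableOn (integrableOn_Cwall hκ hT)
  rw [setIntegral_Ioi_mul_wallMxw hT] at h
  rw [Cwall, ← h]
  refine integral_congr_ae (ae_of_all _ fun v => ?_)
  ring

lemma integrableOn_one_sub_Cwall {κ T : ℝ} (hκ : 0 < κ) (hT : 0 < T) :
    IntegrableOn (fun v => v * (1 - exp (-1 / (κ * v))) * wallMxw T v) (Ioi 0) := by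
  refine Integrable.congr ((integrable_mul_wallMxw hT).integrableOn.sub (integrableOn_Cwall hκ hT))
    (ae_of_all _ fun v => ?_)
  simp only [Pi.sub_apply]
  ring

lemma one_sub_Cwall_nonneg {κ T : ℝ} (hκ : 0 < κ) (hT : 0 < T) : 0 ≤ 1 - Cwall κ T := by
  rw [one_sub_Cwall_eq hκ hT]
  refine setIntegral_nonneg measurableSet_Ioi fun v hv => ?_
  have := exp_neg_div_le_one hκ zero_le_one (le_of_lt hv)
  exact mul_nonneg (mul_nonneg (le_of_lt hv) (by linarith)) (wallMxw_nonneg hT v)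

lemma one_sub_Cwall_le {κ T : ℝ} (hκ : 0 < κ) (hT : 0 < T) :
    1 - Cwall κ T ≤ √(2 * π) / (κ * √T) := by
  rw [one_sub_Cwall_eq hκ hT]
  calc ∫ v in Ioi (0 : ℝ), v * (1 - exp (-1 / (κ * v))) * wallMxw T v
      ≤ ∫ v in Ioi (0 : ℝ), κ⁻¹ * wallMxw T v := by
        refine setIntegral_mono_on (integrableOn_one_sub_Cwall hκ hT)
          ((integrable_wallMxw hT).const_mul _).integrableOn measurableSet_Ioi fun v hv => ?_
        refine mul_le_mul_of_nonneg_right ?_ (wallMxw_nonneg hT v)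
        have hv' : 0 < v := hv
        have h1 := add_one_le_exp (-1 / (κ * v))
        calc v * (1 - exp (-1 / (κ * v))) ≤ v * (-(-1 / (κ * v))) := by gcongr; linarith
          _ = κ⁻¹ := by field_simp
    _ = κ⁻¹ * (T⁻¹ * ∫ v in Ioi (0 : ℝ), exp (-v ^ 2 / (2 * T))) := by
        simp only [wallMxw, integral_const_mul]
    _ ≤ κ⁻¹ * (T⁻¹ * √(π * (2 * T))) := by
        gcongr
        exact setIntegral_Ioi_exp_neg_sq_div_le (by positivity)
    _ = √(2 * π) / (κ * √T) := by
        have hs : 0 < √T := sqrt_pos.2 hT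
        rw [show π * (2 * T) = 2 * π * T by ring, sqrt_mul (by positivity : (0 : ℝ) ≤ 2 * π)]
        have : T⁻¹ = (√T * √T)⁻¹ := by rw [mul_self_sqrt hT.le]
        rw [this]
        field_simp

lemma le_one_sub_Cwall {κ T : ℝ} (hκ : 0 < κ) (hT : 0 < T) (h : 1 ≤ κ ^ 2 * T) :
    exp (-2) / (2 * κ * √T) ≤ 1 - Cwall κ T := by
  rw [one_sub_Cwall_eq hκ hT]
  have hs : 0 < √T := sqrt_pos.2 hT
  have key := mul_length_le_setIntegral (a := √T) (L := √T)
    (c := (2 * κ)⁻¹ * (T⁻¹ * exp (-2))) measurableSet_Ioi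
    (integrableOn_one_sub_Cwall hκ hT) (fun v hv => ?_) hs.le
    (fun v hv => lt_of_lt_of_le hs hv.1) ?_
  · refine le_trans (le_of_eq ?_) key
    have : T⁻¹ = (√T * √T)⁻¹ := by rw [mul_self_sqrt hT.le]
    rw [this]
    field_simp
  · have := exp_neg_div_le_one hκ zero_le_one (le_of_lt hv)
    exact mul_nonneg (mul_nonneg (le_of_lt hv) (by linarith)) (wallMxw_nonneg hT v)
  · intro v hv
    have hv0 : 0 < v := lt_of_lt_of_le hs hv.1
    have hkv : 1 ≤ κ * v := (one_le_kappa_mul_sqrt hκ h).trans (by gcongr; exact hv.1)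
    refine mul_le_mul ?_ ?_ (by positivity) ?_
    · have h1 : exp (-1 / (κ * v)) ≤ (1 + 1 / (κ * v))⁻¹ := by
        rw [neg_div, exp_neg]
        gcongr
        linarith [add_one_le_exp (1 / (κ * v))]
      calc (2 * κ)⁻¹ ≤ v / (κ * v + 1) := by
            rw [inv_eq_one_div, div_le_div_iff₀ (by positivity) (by positivity)]
            nlinarith
        _ = v * (1 - (1 + 1 / (κ * v))⁻¹) := by field_simp; ring
        _ ≤ _ := by gcongr
    · unfold wallMxw
      refine mul_le_mul_of_nonneg_left (exp_neg_two_le_of_mem hT ?_) (by positivity)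
      rw [abs_of_pos hv0]
      linarith [hv.2]
    · have := exp_neg_div_le_one hκ zero_le_one hv0.le
      exact mul_nonneg hv0.le (by linarith)

lemma kinetic_average_le {κ : ℝ} {ρ T s : ℝ → ℝ} (hκ : 0 < κ) (hs : ∀ y ∈ Icc (0 : ℝ) 1, 0 ≤ s y)
    (hρ0 : ∀ y, 0 ≤ ρ y) (hρi : IntegrableOn ρ (Icc 0 1)) (hρ : ∫ y in Icc (0 : ℝ) 1, ρ y = 1)
    (hT0 : ∀ y, 0 < T y) :
    κ⁻¹ * ∫ y in Icc (0 : ℝ) 1, ρ y * ∫ v in Ioi (0 : ℝ), exp (-(s y) / (κ * v)) * Mxw (T y) v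
      ≤ κ⁻¹ := by
  refine mul_le_of_le_one_right (inv_nonneg.2 hκ.le) ?_
  refine le_trans ?_ hρ.le
  refine integral_mono_of_nonneg
    (ae_of_all _ fun y => mul_nonneg (hρ0 y) (integral_exp_mul_Mxw_nonneg κ _ (T y))) hρi
    ((ae_restrict_iff' measurableSet_Icc).2 (ae_of_all _ fun y hy => ?_))
  exact mul_le_of_le_one_right (hρ0 y) (integral_exp_mul_Mxw_le_one hκ (hs y hy) (hT0 y))

lemma le_kinetic_average {κ : ℝ} {ρ T s : ℝ → ℝ} (hκ : 0 < κ) (hs : ∀ y ∈ Icc (0 : ℝ) 1, 0 ≤ s y)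
    (hs1 : ∀ y ∈ Icc (0 : ℝ) 1, s y ≤ 1) (hρ0 : ∀ y, 0 ≤ ρ y) (hρi : IntegrableOn ρ (Icc 0 1))
    (hρ : ∫ y in Icc (0 : ℝ) 1, ρ y = 1) (hT0 : ∀ y, 0 < T y)
    (hT : ∀ y ∈ Icc (0 : ℝ) 1, 1 ≤ κ ^ 2 * T y)
    (hi : IntegrableOn
      (fun y => ρ y * ∫ v in Ioi (0 : ℝ), exp (-(s y) / (κ * v)) * Mxw (T y) v) (Icc (0 : ℝ) 1)) :
    κ⁻¹ * (exp (-3) / √(2 * π)) ≤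
      κ⁻¹ * ∫ y in Icc (0 : ℝ) 1,
        ρ y * ∫ v in Ioi (0 : ℝ), exp (-(s y) / (κ * v)) * Mxw (T y) v := by
  refine mul_le_mul_of_nonneg_left ?_ (inv_nonneg.2 hκ.le)
  calc exp (-3) / √(2 * π) = ∫ y in Icc (0 : ℝ) 1, ρ y * (exp (-3) / √(2 * π)) := by
        rw [integral_mul_const, hρ, one_mul]
    _ ≤ _ := setIntegral_mono_on (hρi.mul_const _) hi measurableSet_Icc fun y hy =>
        mul_le_mul_of_nonneg_left
          (le_integral_exp_mul_Mxw hκ (hs y hy) (hs1 y hy) (hT0 y) (hT y hy)) (hρ0 y)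

lemma exp_neg_sq_div_two_eq {T : ℝ} (v : ℝ) (hT : 0 < T) :
    exp (-v ^ 2 / (2 * T)) = exp (-v ^ 2 / (4 * T)) * exp (-v ^ 2 / (4 * T)) := by
  rw [← exp_add]
  congr 1
  field_simp
  ring

lemma exp_neg_sq_div_mono {T T₂ : ℝ} (v : ℝ) (hT : 0 < T) (hle : T ≤ T₂) :
    exp (-v ^ 2 / (4 * T)) ≤ exp (-v ^ 2 / (4 * T₂)) := by
  rw [exp_le_exp, neg_div, neg_div, neg_le_neg_iff]
  gcongr

lemma sq_mul_wallMxw_le {T T₂ : ℝ} (v : ℝ) (hT : 0 < T) (hle : T ≤ T₂) :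
    v ^ 2 * wallMxw T v ≤ 4 * exp (-v ^ 2 / (4 * T₂)) := by
  have hE : v ^ 2 * T⁻¹ * exp (-v ^ 2 / (4 * T)) ≤ 4 := by
    rw [neg_div, exp_neg, ← div_eq_mul_inv, div_le_iff₀ (exp_pos _)]
    have h1 := add_one_le_exp (v ^ 2 / (4 * T))
    have h2 : v ^ 2 * T⁻¹ = 4 * (v ^ 2 / (4 * T)) := by field_simp
    linarith
  calc v ^ 2 * wallMxw T v
      = (v ^ 2 * T⁻¹ * exp (-v ^ 2 / (4 * T))) * exp (-v ^ 2 / (4 * T)) := by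
        rw [wallMxw, exp_neg_sq_div_two_eq v hT]
        ring
    _ ≤ 4 * exp (-v ^ 2 / (4 * T₂)) :=
        mul_le_mul hE (exp_neg_sq_div_mono v hT hle) (exp_pos _).le (by norm_num)

lemma mul_Mxw_le {T T₂ : ℝ} (v : ℝ) (hT : 0 < T) (hle : T ≤ T₂) :
    v * Mxw T v ≤ exp (-v ^ 2 / (4 * T₂)) := by
  have hE : v * (√(2 * π * T))⁻¹ * exp (-v ^ 2 / (4 * T)) ≤ 1 := by
    rw [neg_div, exp_neg, ← div_eq_mul_inv, div_le_iff₀ (exp_pos _), ← div_eq_mul_inv,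
      div_le_iff₀ (by positivity), one_mul]
    refine le_of_sq_le_sq ?_ (by positivity)
    have h1 := add_one_le_exp (v ^ 2 / (4 * T))
    have hx : 0 ≤ v ^ 2 / (4 * T) := by positivity
    rw [mul_pow, sq_sqrt (by positivity)]
    calc v ^ 2 = 4 * T * (v ^ 2 / (4 * T)) := by field_simp
      _ ≤ (v ^ 2 / (4 * T) + 1) ^ 2 * (2 * π * T) := by
        have : 4 * T ≤ 2 * π * T := by nlinarith [pi_gt_three]
        rw [mul_comm]
        refine mul_le_mul (by nlinarith) this (by positivity) (by positivity)
      _ ≤ exp (v ^ 2 / (4 * T)) ^ 2 * (2 * π * T) := by gcongr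
  calc v * Mxw T v
      = (v * (√(2 * π * T))⁻¹ * exp (-v ^ 2 / (4 * T))) * exp (-v ^ 2 / (4 * T)) := by
        rw [Mxw, exp_neg_sq_div_two_eq v hT]
        ring
    _ ≤ 1 * exp (-v ^ 2 / (4 * T)) := by gcongr
    _ ≤ exp (-v ^ 2 / (4 * T₂)) := by
        rw [one_mul]
        exact exp_neg_sq_div_mono v hT hle

/-- The contribution of the gas to the distribution of right-moving particles at `x = 1`. -/
noncomputable def emission (κ : ℝ) (ρ T : ℝ → ℝ) (v : ℝ) : ℝ :=
  ∫ y in Icc (0 : ℝ) 1, (κ * v)⁻¹ * exp (-(1 - y) / (κ * v)) * ρ y * Mxw (T y) v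

lemma measurable_emission (κ : ℝ) {ρ T : ℝ → ℝ} (hρ : Measurable ρ) (hT : Measurable T) :
    Measurable (emission κ ρ T) := by
  refine StronglyMeasurable.measurable (StronglyMeasurable.integral_prod_right'
    (f := fun p : ℝ × ℝ =>
      (κ * p.1)⁻¹ * exp (-(1 - p.2) / (κ * p.1)) * ρ p.2 * Mxw (T p.2) p.1) ?_)
  refine Measurable.stronglyMeasurable ?_
  unfold Mxw
  fun_prop

lemma emission_nonneg {κ v : ℝ} {ρ T : ℝ → ℝ} (hκ : 0 < κ) (hρ0 : ∀ y, 0 ≤ ρ y) (hv : 0 ≤ v) :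
    0 ≤ emission κ ρ T v :=
  integral_nonneg fun y => by
    have h1 := Mxw_nonneg (T y) v
    have h2 := hρ0 y
    positivity

lemma sq_mul_emission_le {κ v T₂ : ℝ} {ρ T : ℝ → ℝ} (hκ : 0 < κ) (hρ0 : ∀ y, 0 ≤ ρ y)
    (hρi : IntegrableOn ρ (Icc 0 1)) (hρ : ∫ y in Icc (0 : ℝ) 1, ρ y = 1) (hT0 : ∀ y, 0 < T y)
    (hT : ∀ y ∈ Icc (0 : ℝ) 1, T y ≤ T₂) (hv : 0 < v) :
    v ^ 2 * emission κ ρ T v ≤ κ⁻¹ * exp (-v ^ 2 / (4 * T₂)) := by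
  set G := exp (-v ^ 2 / (4 * T₂)) with hG
  calc v ^ 2 * emission κ ρ T v
      = ∫ y in Icc (0 : ℝ) 1,
          v ^ 2 * ((κ * v)⁻¹ * exp (-(1 - y) / (κ * v)) * ρ y * Mxw (T y) v) := by
        rw [emission, integral_const_mul]
    _ ≤ ∫ y in Icc (0 : ℝ) 1, κ⁻¹ * G * ρ y := by
        refine integral_mono_of_nonneg (ae_of_all _ fun y => ?_) (hρi.const_mul _)
          ((ae_restrict_iff' measurableSet_Icc).2 (ae_of_all _ fun y hy => ?_))
        · have h1 := Mxw_nonneg (T y) v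
          have h2 := hρ0 y
          positivity
        · have h1 := mul_Mxw_le v (hT0 y) (hT y hy)
          have h2 := exp_neg_div_le_one hκ (sub_nonneg.2 hy.2) hv.le
          have h3 := hρ0 y
          have h4 := Mxw_nonneg (T y) v
          calc v ^ 2 * ((κ * v)⁻¹ * exp (-(1 - y) / (κ * v)) * ρ y * Mxw (T y) v)
              = κ⁻¹ * (v * Mxw (T y) v) * ρ y * exp (-(1 - y) / (κ * v)) := by
                field_simp
            _ ≤ κ⁻¹ * G * ρ y * 1 := by gcongr
            _ = κ⁻¹ * G * ρ y := mul_one _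
    _ = κ⁻¹ * G := by rw [integral_const_mul, hρ, mul_one]

set_option maxHeartbeats 1600000 in
/-- two-sided bound `c⁻¹√(T₁T₂) ≤ P ≤ c√(T₁T₂)` on the pressure at `x = 1`. -/
theorem pressure_bounds :
    ∃ Θ c : ℝ, 1 ≤ Θ ∧ 1 ≤ c ∧
      ∀ κ T₁ T₂ : ℝ, 0 < κ → 0 < T₁ → 0 < T₂ → Θ ≤ κ ^ 2 * T₁ → T₁ ≤ T₂ →
        ∀ ρ T : ℝ → ℝ, Measurable ρ → (∀ y, 0 ≤ ρ y) →
          (∫ y in Icc (0 : ℝ) 1, ρ y) = 1 →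
          Measurable T → (∀ y, 0 < T y) →
          (∀ y ∈ Icc (0 : ℝ) 1, T₁ ≤ T y ∧ T y ≤ T₂) →
          ∀ f : ℝ → ℝ → ℝ, (∀ x v, 0 ≤ f x v) →
            IsMildSteadyState κ T₁ T₂ ρ T f →
            c⁻¹ * Real.sqrt (T₁ * T₂) ≤ (∫ v, v ^ 2 * f 1 v) ∧
            (∫ v, v ^ 2 * f 1 v) ≤ c * Real.sqrt (T₁ * T₂) := by
  set e2 : ℝ := exp 2 with he2
  have he2' : 1 ≤ e2 := one_le_exp (by norm_num)
  have hπ4 : 1 ≤ √(π * 4) := one_le_sqrt.2 (by linarith [pi_gt_three])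
  refine ⟨1, (32 * e2 + 1) * √(π * 4) + 4 * π * exp 5, le_rfl, ?_, ?_⟩
  · have : 0 ≤ 4 * π * exp 5 := by positivity
    nlinarith
  intro κ T₁ T₂ hκ hT₁ hT₂ hΘ hle ρ T hρm hρ0 hρ hTm hT0 hT f hf ⟨hD, hm, hp, _, hmild⟩
  obtain ⟨hpos, hneg⟩ := hmild 1 (by simp)
  have hΘ2 : 1 ≤ κ ^ 2 * T₂ := hΘ.trans (by gcongr)
  have hΘT : ∀ y ∈ Icc (0 : ℝ) 1, 1 ≤ κ ^ 2 * T y := fun y hy =>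
    hΘ.trans (by gcongr; exact (hT y hy).1)
  have hs1 : 0 < √T₁ := sqrt_pos.2 hT₁
  have hs2 : 0 < √T₂ := sqrt_pos.2 hT₂
  have hs12 : √T₁ ≤ √T₂ := sqrt_le_sqrt hle
  have hκs : κ⁻¹ ≤ √T₁ := by
    rw [inv_le_iff_one_le_mul₀' hκ]
    exact one_le_kappa_mul_sqrt hκ hΘ
  have hρi : IntegrableOn ρ (Icc 0 1) := by
    by_contra hni
    rw [integral_undef hni] at hρ
    exact zero_ne_one hρ
  have hM0 : 0 ≤ Cminus κ ρ T := mul_nonneg (inv_nonneg.2 hκ.le)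
    (integral_nonneg fun y => mul_nonneg (hρ0 y) (integral_exp_mul_Mxw_nonneg κ y (T y)))
  have hM1 : Cminus κ ρ T ≤ κ⁻¹ :=
    kinetic_average_le hκ (fun y hy => hy.1) hρ0 hρi hρ hT0
  have hP1 : Cplus κ ρ T ≤ κ⁻¹ :=
    kinetic_average_le hκ (fun y hy => sub_nonneg.2 hy.2) hρ0 hρi hρ hT0
  have hP : κ⁻¹ * (exp (-3) / √(2 * π)) ≤ Cplus κ ρ T :=
    le_kinetic_average hκ (fun y hy => sub_nonneg.2 hy.2) (fun y hy => sub_le_self _ hy.1)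
      hρ0 hρi hρ hT0 hΘT hp
  have hP0 : 0 ≤ Cplus κ ρ T := le_trans (by positivity) hP
  set P := Cplus κ ρ T
  set M := Cminus κ ρ T
  have hC10 : 0 ≤ Cwall κ T₁ := Cwall_nonneg hT₁
  have hC20 : 0 ≤ Cwall κ T₂ := Cwall_nonneg hT₂
  have hC11 := one_sub_Cwall_nonneg hκ hT₁
  have hC21 := one_sub_Cwall_nonneg hκ hT₂
  have hC1l := le_one_sub_Cwall hκ hT₁ hΘ
  have hC1u := one_sub_Cwall_le hκ hT₁
  have hC2u := one_sub_Cwall_le hκ hT₂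
  set C₁ := Cwall κ T₁
  set C₂ := Cwall κ T₂
  have hDl : exp (-2) / (2 * κ * √T₁) ≤ 1 - C₁ * C₂ := by nlinarith
  have hDu : 1 - C₁ * C₂ ≤ 2 * √(2 * π) / (κ * √T₁) := by
    have h1 : √(2 * π) / (κ * √T₂) ≤ √(2 * π) / (κ * √T₁) := by gcongr
    calc 1 - C₁ * C₂ ≤ (1 - C₁) + (1 - C₂) := by nlinarith
      _ ≤ √(2 * π) / (κ * √T₁) + √(2 * π) / (κ * √T₁) := by linarith
      _ = _ := by ring
  have hDp : 0 < 1 - C₁ * C₂ := by linarith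
  have hratio : ∀ n : ℝ, 0 ≤ n → n ≤ 2 * κ⁻¹ → n / (1 - C₁ * C₂) ≤ 4 * e2 * √T₁ := by
    intro n hn0 hn
    calc n / (1 - C₁ * C₂) ≤ 2 * κ⁻¹ / (exp (-2) / (2 * κ * √T₁)) := by gcongr
      _ = 4 * e2 * √T₁ := by
        rw [he2, exp_neg]
        field_simp
        norm_num
  have hA0 : 0 ≤ (M + C₂ * P) / (1 - C₁ * C₂) := by positivity
  have hB0 : 0 ≤ (P + C₁ * M) / (1 - C₁ * C₂) := by positivity
  have hA : (M + C₂ * P) / (1 - C₁ * C₂) ≤ 4 * e2 * √T₁ :=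
    hratio _ (by positivity) (by nlinarith)
  have hB : (P + C₁ * M) / (1 - C₁ * C₂) ≤ 4 * e2 * √T₁ :=
    hratio _ (by positivity) (by nlinarith)
  have hBl : exp (-3) / (4 * π) * √T₁ ≤ (P + C₁ * M) / (1 - C₁ * C₂) := by
    calc exp (-3) / (4 * π) * √T₁
        = κ⁻¹ * (exp (-3) / √(2 * π)) / (2 * √(2 * π) / (κ * √T₁)) := by
          have h2 : √(2 * π) * √(2 * π) = 2 * π := mul_self_sqrt (by positivity)
          have h3 : (4 * π : ℝ) = 2 * (√(2 * π) * √(2 * π)) := by rw [h2]; ring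
          rw [h3]
          field_simp
      _ ≤ (P + C₁ * M) / (1 - C₁ * C₂) := by
          gcongr
          have : 0 ≤ C₁ * M := by positivity
          linarith
  set A := (M + C₂ * P) / (1 - C₁ * C₂)
  set B := (P + C₁ * M) / (1 - C₁ * C₂)
  set h : ℝ → ℝ := fun v => if 0 < v then
    v ^ 2 * (exp (-1 / (κ * v)) * wallMxw T₁ v * A + emission κ ρ T v)
    else v ^ 2 * (wallMxw T₂ v * B) with hh
  have hfh : (fun v => v ^ 2 * f 1 v) =ᵐ[volume] h := by
    rw [ae_restrict_iff' measurableSet_Ioi] at hpos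
    rw [ae_restrict_iff' measurableSet_Iio] at hneg
    filter_upwards [hpos, hneg] with v h1 h2
    rcases lt_trichotomy v 0 with hv | hv | hv
    · simp [hh, h2 hv, hv.not_gt]
    · simp [hh, hv]
    · simp only [hh, h1 hv, if_pos hv, emission]
      rw [intervalIntegral.integral_of_le zero_le_one, integral_Icc_eq_integral_Ioc]
  have hhm : Measurable h := by
    refine Measurable.ite measurableSet_Ioi ?_ ?_
    · have := measurable_emission κ hρm hTm
      unfold wallMxw
      fun_prop
    · unfold wallMxw
      fun_prop
  have hh0 : ∀ v, 0 ≤ h v := by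
    intro v
    simp only [hh]
    have h1 := wallMxw_nonneg hT₁ v
    have h2 := wallMxw_nonneg hT₂ v
    split_ifs with hv
    · have := emission_nonneg (T := T) hκ hρ0 hv.le
      positivity
    · positivity
  have hhu : ∀ v, h v ≤ (4 * A + 4 * B + κ⁻¹) * exp (-v ^ 2 / (4 * T₂)) := by
    intro v
    have h1 := sq_mul_wallMxw_le v hT₁ hle
    have h2 := sq_mul_wallMxw_le v hT₂ le_rfl
    set G := exp (-v ^ 2 / (4 * T₂))
    have hG : 0 < G := exp_pos _
    have hk : 0 < κ⁻¹ := inv_pos.2 hκ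
    simp only [hh]
    split_ifs with hv
    · have h3 := sq_mul_emission_le hκ hρ0 hρi hρ hT0 (fun y hy => (hT y hy).2) hv
      have h4 := exp_neg_div_le_one hκ zero_le_one hv.le
      calc v ^ 2 * (exp (-1 / (κ * v)) * wallMxw T₁ v * A + emission κ ρ T v)
          = exp (-1 / (κ * v)) * (v ^ 2 * wallMxw T₁ v * A) + v ^ 2 * emission κ ρ T v := by ring
        _ ≤ 1 * (4 * G * A) + κ⁻¹ * G := by
            have := wallMxw_nonneg hT₁ v
            gcongr
        _ ≤ _ := by nlinarith [mul_nonneg hB0 hG.le]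
    · calc v ^ 2 * (wallMxw T₂ v * B) = v ^ 2 * wallMxw T₂ v * B := by ring
        _ ≤ 4 * G * B := by gcongr
        _ ≤ _ := by nlinarith [mul_nonneg hA0 hG.le, mul_pos hk hG]
  have hGi := (integrable_exp_neg_sq_div (by positivity : 0 < 4 * T₂)).const_mul
    (4 * A + 4 * B + κ⁻¹)
  have hhi : Integrable h := hGi.mono' hhm.aestronglyMeasurable (ae_of_all _ fun v => by
    rw [norm_of_nonneg (hh0 v)]
    exact hhu v)
  rw [integral_congr_ae hfh, sqrt_mul hT₁.le]
  constructor
  · have key := mul_length_le_setIntegral (a := -(2 * √T₂)) (L := √T₂) (c := exp (-2) * B)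
      MeasurableSet.univ hhi.integrableOn (fun v _ => hh0 v) hs2.le (subset_univ _) ?_
    · rw [setIntegral_univ] at key
      refine le_trans ?_ key
      have h5 : (4 * π * exp 5)⁻¹ = exp (-2) * (exp (-3) / (4 * π)) := by
        rw [mul_inv, ← exp_neg, show (-5 : ℝ) = -2 + -3 by norm_num, exp_add]
        ring
      calc ((32 * e2 + 1) * √(π * 4) + 4 * π * exp 5)⁻¹ * (√T₁ * √T₂)
          ≤ (4 * π * exp 5)⁻¹ * (√T₁ * √T₂) := by
            gcongr
            exact le_add_of_nonneg_left (by positivity)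
        _ = exp (-2) * (exp (-3) / (4 * π) * √T₁) * √T₂ := by rw [h5]; ring
        _ ≤ exp (-2) * B * √T₂ := by gcongr
    · intro v hv
      have hv0 : ¬ 0 < v := by linarith [hv.2]
      simp only [hh, if_neg hv0]
      have h6 : T₂ ≤ v ^ 2 := by
        rw [← sq_sqrt hT₂.le, ← neg_sq v]
        have : √T₂ ≤ -v := by linarith [hv.2]
        gcongr
      have h7 : exp (-2) ≤ exp (-v ^ 2 / (2 * T₂)) :=
        exp_neg_two_le_of_mem hT₂ (by rw [abs_le]; constructor <;> linarith [hv.1, hv.2])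
      calc exp (-2) * B = T₂ * (T₂⁻¹ * exp (-2) * B) := by field_simp
        _ ≤ v ^ 2 * (wallMxw T₂ v * B) := by
          unfold wallMxw
          gcongr
  · calc ∫ v, h v ≤ ∫ v, (4 * A + 4 * B + κ⁻¹) * exp (-v ^ 2 / (4 * T₂)) :=
          integral_mono hhi hGi hhu
      _ = (4 * A + 4 * B + κ⁻¹) * (√(π * 4) * √T₂) := by
          rw [integral_const_mul, integral_exp_neg_sq_div, ← mul_assoc, sqrt_mul (by positivity)]
      _ ≤ ((32 * e2 + 1) * √T₁) * (√(π * 4) * √T₂) := by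
          gcongr
          linarith
      _ ≤ _ := by
          have : 0 ≤ 4 * π * exp 5 * (√T₁ * √T₂) := by positivity
          linarith
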